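/- Let ε, μ > 0 and β ∈ ℝ. Let U : ℝ × ℝ³ → ℝ³ be a smooth (C⁴) vector field with div U ≡ 0, viewed as a purely vectorial biquaternion-valued function. Then M M* U = rot rot U + εμ ∂ₜ²U + 2βεμ ∂ₜ² rot U + β²εμ ∂ₜ² rot rot U. -/

import Mathlib

set_option linter.unusedSimpArgs false

noncomputable section

/-- Points of `ℝ³`. -/
abbrev V3 : Type := Fin 3 → ℝ

/-- Biquaternions `ℍ[ℂ]`: quaternions with complex coefficients. -/
abbrev BQ : Type := Quaternion ℂ

/-- Euclidean norm on `ℝ³`. -/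
def enorm3 (x : V3) : ℝ := Real.sqrt (x 0 ^ 2 + x 1 ^ 2 + x 2 ^ 2)

/-- Spatial partial derivative of a real-valued function. -/
def pdR (k : Fin 3) (g : V3 → ℝ) (x : V3) : ℝ := fderiv ℝ g x (Pi.single k 1)

/-- Spatial partial derivative of a complex-valued function. -/
def pdC (k : Fin 3) (g : V3 → ℂ) (x : V3) : ℂ := fderiv ℝ g x (Pi.single k 1)

/-- Divergence (in the space variables) of a time-dependent vector field. -/
def div3 (E : ℝ × V3 → V3) (p : ℝ × V3) : ℝ :=
  ∑ k : Fin 3, pdR k (fun y => E (p.1, y) k) p.2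

/-- Curl (in the space variables) of a time-dependent vector field. -/
def rot3 (E : ℝ × V3 → V3) (p : ℝ × V3) : V3 :=
  ![pdR 1 (fun y => E (p.1, y) 2) p.2 - pdR 2 (fun y => E (p.1, y) 1) p.2,
    pdR 2 (fun y => E (p.1, y) 0) p.2 - pdR 0 (fun y => E (p.1, y) 2) p.2,
    pdR 0 (fun y => E (p.1, y) 1) p.2 - pdR 1 (fun y => E (p.1, y) 0) p.2]

/-- Time derivative of a vector field. -/
def ptV (E : ℝ × V3 → V3) (p : ℝ × V3) : V3 := deriv (fun s => E (s, p.2)) p.1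

/-- Time derivative of a scalar (real-valued) function. -/
def ptR (ρ : ℝ × V3 → ℝ) (p : ℝ × V3) : ℝ := deriv (fun s => ρ (s, p.2)) p.1

/-- Build a biquaternion from a complex scalar part and a complex vector part. -/
def bq (s : ℂ) (v : Fin 3 → ℂ) : BQ := ⟨s, v 0, v 1, v 2⟩

/-- A complex vector as a purely vectorial biquaternion. -/
def vecC (v : Fin 3 → ℂ) : BQ := bq 0 v

/-- A real vector as a purely vectorial biquaternion. -/
def vecR (v : V3) : BQ := vecC (fun k => (v k : ℂ))

/-- The basic quaternionic imaginary units `i₁, i₂, i₃`. -/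
def qi : Fin 3 → BQ := ![⟨0,1,0,0⟩, ⟨0,0,1,0⟩, ⟨0,0,0,1⟩]

/-- Componentwise spatial partial derivative of a biquaternion-valued function. -/
def pdQ (k : Fin 3) (F : V3 → BQ) (x : V3) : BQ :=
  ⟨pdC k (fun y => (F y).re) x, pdC k (fun y => (F y).imI) x,
   pdC k (fun y => (F y).imJ) x, pdC k (fun y => (F y).imK) x⟩

/-- The Moisil–Teodoresco operator `D F = i₁ ∂₁F + i₂ ∂₂F + i₃ ∂₃F`. -/
def Dop (F : V3 → BQ) (x : V3) : BQ :=
  qi 0 * pdQ 0 F x + qi 1 * pdQ 1 F x + qi 2 * pdQ 2 F x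

/-- The Moisil–Teodoresco operator acting in the space variables. -/
def DQ (F : ℝ × V3 → BQ) (p : ℝ × V3) : BQ := Dop (fun y => F (p.1, y)) p.2

/-- Componentwise time derivative of a biquaternion-valued function. -/
def ptQ (F : ℝ × V3 → BQ) (p : ℝ × V3) : BQ :=
  ⟨deriv (fun s => (F (s, p.2)).re) p.1, deriv (fun s => (F (s, p.2)).imI) p.1,
   deriv (fun s => (F (s, p.2)).imJ) p.1, deriv (fun s => (F (s, p.2)).imK) p.1⟩

/-- The operator `M = β√(εμ) ∂ₜ D + √(εμ) ∂ₜ − iD`. -/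
def Mop (ε μ β : ℝ) (F : ℝ × V3 → BQ) (p : ℝ × V3) : BQ :=
  ((β * Real.sqrt (ε * μ) : ℝ) : ℂ) • ptQ (DQ F) p
    + ((Real.sqrt (ε * μ) : ℝ) : ℂ) • ptQ F p
    - Complex.I • DQ F p

/-- The complex conjugate operator `M* = β√(εμ) ∂ₜ D + √(εμ) ∂ₜ + iD`. -/
def MstarOp (ε μ β : ℝ) (F : ℝ × V3 → BQ) (p : ℝ × V3) : BQ :=
  ((β * Real.sqrt (ε * μ) : ℝ) : ℂ) • ptQ (DQ F) p
    + ((Real.sqrt (ε * μ) : ℝ) : ℂ) • ptQ F p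
    + Complex.I • DQ F p

/-- `C^n` smoothness of a biquaternion-valued function, componentwise. -/
def ContDiffQ (n : ℕ∞) (F : ℝ × V3 → BQ) : Prop :=
  ContDiff ℝ n (fun p => (F p).re) ∧ ContDiff ℝ n (fun p => (F p).imI) ∧
  ContDiff ℝ n (fun p => (F p).imJ) ∧ ContDiff ℝ n (fun p => (F p).imK)

/-- `Θ_α(x) = −e^{iα|x|}/(4π|x|)`. -/
def Theta (α : ℂ) (x : V3) : ℂ :=
  -Complex.exp (Complex.I * α * (enorm3 x : ℝ)) / (4 * Real.pi * (enorm3 x : ℝ))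

/-- `𝒦_α(x) = (α + x/|x|² − iα x/|x|) Θ_α(x)`. -/
def Kfun (α : ℂ) (x : V3) : BQ :=
  Theta α x • ((α : BQ) + (((enorm3 x ^ 2)⁻¹ : ℝ) : ℂ) • vecR x
    - (Complex.I * α * ((enorm3 x : ℝ) : ℂ)⁻¹) • vecR x)


lemma aux_pdC (k : Fin 3) (a b : V3 → ℝ) (x : V3) (ha : DifferentiableAt ℝ a x)
    (hb : DifferentiableAt ℝ b x) :
    pdC k (fun y => (a y : ℂ) + Complex.I * (b y : ℂ)) x
      = (pdR k a x : ℂ) + Complex.I * (pdR k b x : ℂ) := by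
  have h1 : HasFDerivAt (fun y => (a y : ℂ)) (Complex.ofRealCLM.comp (fderiv ℝ a x)) x :=
    Complex.ofRealCLM.hasFDerivAt.comp x ha.hasFDerivAt
  have h2 : HasFDerivAt (fun y => (b y : ℂ)) (Complex.ofRealCLM.comp (fderiv ℝ b x)) x :=
    Complex.ofRealCLM.hasFDerivAt.comp x hb.hasFDerivAt
  have h3 := h1.add (h2.const_mul Complex.I)
  unfold pdC pdR
  have h4 := h3.fderiv
  have h5 : (fun y => (a y : ℂ) + Complex.I * (b y : ℂ))
    = (fun y => (a y : ℂ)) + fun y => Complex.I * (b y : ℂ) := rfl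
  rw [h5, h4]
  simp

lemma aux_dt (a b : ℝ → ℝ) (x : ℝ) (ha : DifferentiableAt ℝ a x)
    (hb : DifferentiableAt ℝ b x) :
    deriv (fun y => (a y : ℂ) + Complex.I * (b y : ℂ)) x
      = ((deriv a x : ℝ) : ℂ) + Complex.I * ((deriv b x : ℝ) : ℂ) :=
  (ha.hasDerivAt.ofReal_comp.add (hb.hasDerivAt.ofReal_comp.const_mul Complex.I)).deriv

/-- directional derivative -/
def dd (v : ℝ × V3) (g : ℝ × V3 → ℝ) (p : ℝ × V3) : ℝ := fderiv ℝ g p v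

def eT : ℝ × V3 := (1, 0)
def eX (k : Fin 3) : ℝ × V3 := (0, Pi.single k 1)

lemma aux_slx {g : ℝ × V3 → ℝ} (hg : ContDiff ℝ 1 g) (p : ℝ × V3) :
    HasFDerivAt (fun y => g (p.1, y)) ((fderiv ℝ g p).comp (ContinuousLinearMap.inr ℝ ℝ V3)) p.2 := by
  have h : HasFDerivAt g (fderiv ℝ g p) (p.1, p.2) :=
    ((hg.differentiable one_ne_zero) p).hasFDerivAt
  exact h.comp p.2 (hasFDerivAt_prodMk_right p.1 p.2)

lemma aux_slt {g : ℝ × V3 → ℝ} (hg : ContDiff ℝ 1 g) (p : ℝ × V3) :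
    HasDerivAt (fun s => g (s, p.2)) (dd eT g p) p.1 := by
  have h : HasFDerivAt g (fderiv ℝ g p) (p.1, p.2) :=
    ((hg.differentiable one_ne_zero) p).hasFDerivAt
  have h2 : HasDerivAt (fun s : ℝ => (s, p.2)) ((1 : ℝ), (0 : V3)) p.1 :=
    (hasDerivAt_id p.1).prodMk (hasDerivAt_const p.1 p.2)
  exact h.comp_hasDerivAt p.1 h2

lemma pdR_eq {g : ℝ × V3 → ℝ} (hg : ContDiff ℝ 1 g) (k : Fin 3) (p : ℝ × V3) :
    pdR k (fun y => g (p.1, y)) p.2 = dd (eX k) g p := by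
  unfold pdR
  rw [(aux_slx hg p).fderiv]
  simp [dd, eX]

lemma dd_smooth {g : ℝ × V3 → ℝ} {n m : ℕ} (hg : ContDiff ℝ n g) (h : m + 1 ≤ n)
    (v : ℝ × V3) : ContDiff ℝ m (dd v g) := by
  unfold dd
  exact (hg.fderiv_right (m := m) (by exact_mod_cast h)).clm_apply contDiff_const

lemma dd_comm {g : ℝ × V3 → ℝ} (hg : ContDiff ℝ 2 g) (v w p : ℝ × V3) :
    dd v (dd w g) p = dd w (dd v g) p := by
  have hs : IsSymmSndFDerivAt ℝ g p := hg.contDiffAt.isSymmSndFDerivAt (by simp)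
  have hd : DifferentiableAt ℝ (fderiv ℝ g) p :=
    ((hg.fderiv_right (m := 1) (by norm_num)).differentiable one_ne_zero) p
  have key : ∀ v w : ℝ × V3, dd v (dd w g) p = fderiv ℝ (fderiv ℝ g) p v w := by
    intro v w
    have := (hd.hasFDerivAt.clm_apply (hasFDerivAt_const w p)).fderiv
    unfold dd
    rw [this]; simp
  rw [key, key]
  exact hs v w

lemma dd_add {f g : ℝ × V3 → ℝ} (hf : ContDiff ℝ 1 f) (hg : ContDiff ℝ 1 g) (v p : ℝ × V3) :
    dd v (fun q => f q + g q) p = dd v f p + dd v g p := by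
  have := (((hf.differentiable one_ne_zero) p).hasFDerivAt.add
    ((hg.differentiable one_ne_zero) p).hasFDerivAt).fderiv
  unfold dd
  change (fderiv ℝ (f + g) p) v = _
  rw [this]; simp

lemma dd_sub {f g : ℝ × V3 → ℝ} (hf : ContDiff ℝ 1 f) (hg : ContDiff ℝ 1 g) (v p : ℝ × V3) :
    dd v (fun q => f q - g q) p = dd v f p - dd v g p := by
  have := (((hf.differentiable one_ne_zero) p).hasFDerivAt.sub
    ((hg.differentiable one_ne_zero) p).hasFDerivAt).fderiv
  unfold dd
  change (fderiv ℝ (f - g) p) v = _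
  rw [this]; simp

lemma dd_smul {f : ℝ × V3 → ℝ} (hf : ContDiff ℝ 1 f) (c : ℝ) (v p : ℝ × V3) :
    dd v (fun q => c * f q) p = c * dd v f p := by
  have := (((hf.differentiable one_ne_zero) p).hasFDerivAt.const_mul c).fderiv
  unfold dd
  rw [this]; simp

lemma comp_smooth {E : ℝ × V3 → V3} {n m : ℕ} (hE : ContDiff ℝ n E) (h : m ≤ n) (k : Fin 3) :
    ContDiff ℝ m (fun q => E q k) :=
  (contDiff_pi.1 hE k).of_le (by exact_mod_cast h)

lemma div_eq {E : ℝ × V3 → V3} {n : ℕ} (hE : ContDiff ℝ n E) (h : 1 ≤ n) (p : ℝ × V3) :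
    div3 E p = dd (eX 0) (fun q => E q 0) p + dd (eX 1) (fun q => E q 1) p
      + dd (eX 2) (fun q => E q 2) p := by
  have hc : ∀ k, ContDiff ℝ 1 (fun q => E q k) := fun k => by
    exact_mod_cast comp_smooth hE h k
  simp only [div3, Fin.sum_univ_three]
  rw [← pdR_eq (hc 0), ← pdR_eq (hc 1), ← pdR_eq (hc 2)]

lemma rot_eq {E : ℝ × V3 → V3} {n : ℕ} (hE : ContDiff ℝ n E) (h : 1 ≤ n) :
    rot3 E = fun p =>
     ![dd (eX 1) (fun q => E q 2) p - dd (eX 2) (fun q => E q 1) p,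
       dd (eX 2) (fun q => E q 0) p - dd (eX 0) (fun q => E q 2) p,
       dd (eX 0) (fun q => E q 1) p - dd (eX 1) (fun q => E q 0) p] := by
  have hc : ∀ k, ContDiff ℝ 1 (fun q => E q k) := fun k => by
    exact_mod_cast comp_smooth hE h k
  funext p
  simp only [← pdR_eq (hc _)]
  rfl

lemma pt_eq {E : ℝ × V3 → V3} {n : ℕ} (hE : ContDiff ℝ n E) (h : 1 ≤ n) :
    ptV E = fun p k => dd eT (fun q => E q k) p := by
  have hc : ∀ k, ContDiff ℝ 1 (fun q => E q k) := fun k => by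
    exact_mod_cast comp_smooth hE h k
  funext p
  exact (hasDerivAt_pi.2 fun k => aux_slt (hc k) p).deriv

lemma rot_smooth {E : ℝ × V3 → V3} {n m : ℕ} (hE : ContDiff ℝ n E) (h : m + 1 ≤ n) :
    ContDiff ℝ m (rot3 E) := by
  rw [rot_eq hE (by omega), contDiff_pi]
  have hd : ∀ j k, ContDiff ℝ m (dd (eX j) (fun q => E q k)) := fun j k =>
    dd_smooth (comp_smooth hE le_rfl k) h _
  intro k
  fin_cases k
  · exact (hd 1 2).sub (hd 2 1)
  · exact (hd 2 0).sub (hd 0 2)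
  · exact (hd 0 1).sub (hd 1 0)

lemma pt_smooth {E : ℝ × V3 → V3} {n m : ℕ} (hE : ContDiff ℝ n E) (h : m + 1 ≤ n) :
    ContDiff ℝ m (ptV E) := by
  rw [pt_eq hE (by omega), contDiff_pi]
  exact fun k => dd_smooth (comp_smooth hE le_rfl k) h _

lemma rot_pt {E : ℝ × V3 → V3} {n : ℕ} (hE : ContDiff ℝ n E) (h : 2 ≤ n) :
    rot3 (ptV E) = ptV (rot3 E) := by
  have hc : ∀ k, ContDiff ℝ 2 (fun q => E q k) := fun k => by
    exact_mod_cast comp_smooth hE h k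
  have hd : ∀ v k, ContDiff ℝ 1 (dd v (fun q => E q k)) := fun v k => by
    exact_mod_cast dd_smooth (m := 1) (comp_smooth hE le_rfl k) h v
  rw [rot_eq (pt_smooth (m := 1) hE h) le_rfl, pt_eq (rot_smooth (m := 1) hE h) le_rfl,
    rot_eq hE (by omega), pt_eq hE (by omega)]
  have e : ∀ k, (fun q => dd eT (fun q => E q k) q) = dd eT (fun q => E q k) := fun k => rfl
  funext p k
  fin_cases k <;>
  · simp only [Fin.zero_eta, Fin.mk_one, Fin.reduceFinMk, Matrix.cons_val]
    rw [dd_sub (hd _ _) (hd _ _), dd_comm (hc _) eT, dd_comm (hc _) eT]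

lemma div_pt {E : ℝ × V3 → V3} {n : ℕ} (hE : ContDiff ℝ n E) (h : 2 ≤ n)
    (h0 : ∀ p, div3 E p = 0) (p : ℝ × V3) : div3 (ptV E) p = 0 := by
  have hc : ∀ k, ContDiff ℝ 2 (fun q => E q k) := fun k => by
    exact_mod_cast comp_smooth hE h k
  have hd : ∀ v k, ContDiff ℝ 1 (dd v (fun q => E q k)) := fun v k => by
    exact_mod_cast dd_smooth (m := 1) (comp_smooth hE le_rfl k) h v
  rw [div_eq (pt_smooth (m := 1) hE h) le_rfl, pt_eq hE (by omega)]
  change dd (eX 0) (dd eT (fun q => E q 0)) p + dd (eX 1) (dd eT (fun q => E q 1)) p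
    + dd (eX 2) (dd eT (fun q => E q 2)) p = 0
  rw [dd_comm (hc _) _ eT, dd_comm (hc _) _ eT, dd_comm (hc _) _ eT,
    ← dd_add (hd _ _) (hd _ _), ← dd_add ((hd _ _).add (hd _ _)) (hd _ _)]
  have : (fun q => dd (eX 0) (fun q => E q 0) q + dd (eX 1) (fun q => E q 1) q
      + dd (eX 2) (fun q => E q 2) q) = fun _ => 0 := by
    funext q
    rw [← div_eq hE (by omega), h0]
  rw [this]
  simp [dd]

lemma div_rot {E : ℝ × V3 → V3} {n : ℕ} (hE : ContDiff ℝ n E) (h : 2 ≤ n)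
    (p : ℝ × V3) : div3 (rot3 E) p = 0 := by
  have hc : ∀ k, ContDiff ℝ 2 (fun q => E q k) := fun k => by
    exact_mod_cast comp_smooth hE h k
  have hd : ∀ v k, ContDiff ℝ 1 (dd v (fun q => E q k)) := fun v k => by
    exact_mod_cast dd_smooth (m := 1) (comp_smooth hE le_rfl k) h v
  rw [div_eq (rot_smooth (m := 1) hE h) le_rfl, rot_eq hE (by omega)]
  simp only [Matrix.cons_val]
  rw [dd_sub (hd _ _) (hd _ _), dd_sub (hd _ _) (hd _ _), dd_sub (hd _ _) (hd _ _),
    dd_comm (hc _) (eX 1) (eX 0), dd_comm (hc _) (eX 2) (eX 0), dd_comm (hc _) (eX 2) (eX 1)]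
  ring

lemma lin_smooth {A B : ℝ × V3 → V3} (hA : ContDiff ℝ 1 A) (hB : ContDiff ℝ 1 B) (a b : ℝ)
    : ContDiff ℝ ((1 : ℕ) : WithTop ℕ∞) (fun q => a • A q + b • B q) := by
  exact_mod_cast (hA.const_smul a).add (hB.const_smul b)

lemma dd_lin {A B : ℝ × V3 → V3} (hA : ContDiff ℝ 1 A) (hB : ContDiff ℝ 1 B) (a b : ℝ)
    (v p : ℝ × V3) (k : Fin 3) : dd v (fun q => (a • A q + b • B q) k) p
    = a * dd v (fun q => A q k) p + b * dd v (fun q => B q k) p := by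
  have hA' := contDiff_pi.1 hA k
  have hB' := contDiff_pi.1 hB k
  simp only [Pi.add_apply, Pi.smul_apply, smul_eq_mul]
  rw [dd_add (contDiff_const.mul hA') (contDiff_const.mul hB'), dd_smul hA', dd_smul hB']

lemma rot_lin {A B : ℝ × V3 → V3} (hA : ContDiff ℝ 1 A) (hB : ContDiff ℝ 1 B) (a b : ℝ)
    : rot3 (fun q => a • A q + b • B q) = fun q => a • rot3 A q + b • rot3 B q := by
  rw [rot_eq (lin_smooth hA hB a b) le_rfl, rot_eq (n := 1) (by exact_mod_cast hA) le_rfl,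
    rot_eq (n := 1) (by exact_mod_cast hB) le_rfl]
  simp only [dd_lin hA hB]
  funext p k
  fin_cases k <;> simp <;> ring

lemma pt_lin {A B : ℝ × V3 → V3} (hA : ContDiff ℝ 1 A) (hB : ContDiff ℝ 1 B) (a b : ℝ)
    : ptV (fun q => a • A q + b • B q) = fun q => a • ptV A q + b • ptV B q := by
  rw [pt_eq (lin_smooth hA hB a b) le_rfl, pt_eq (n := 1) (by exact_mod_cast hA) le_rfl,
    pt_eq (n := 1) (by exact_mod_cast hB) le_rfl]
  simp only [dd_lin hA hB]
  funext p k
  simp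

lemma div_lin {A B : ℝ × V3 → V3} (hA : ContDiff ℝ 1 A) (hB : ContDiff ℝ 1 B) (a b : ℝ)
    (p : ℝ × V3) : div3 (fun q => a • A q + b • B q) p = a * div3 A p + b * div3 B p := by
  rw [div_eq (lin_smooth hA hB a b) le_rfl, div_eq (n := 1) (by exact_mod_cast hA) le_rfl,
    div_eq (n := 1) (by exact_mod_cast hB) le_rfl]
  simp only [dd_lin hA hB]
  ring

/-- complex combination -/
def cq (A B : ℝ × V3 → V3) (q : ℝ × V3) : BQ := vecR (A q) + Complex.I • vecR (B q)

/-- constructor with the quaternion type -/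
def qmk (a b c d : ℂ) : BQ := ⟨a, b, c, d⟩
lemma qmk_re (a b c d : ℂ) : (qmk a b c d).re = a := rfl
lemma qmk_imI (a b c d : ℂ) : (qmk a b c d).imI = b := rfl
lemma qmk_imJ (a b c d : ℂ) : (qmk a b c d).imJ = c := rfl
lemma qmk_imK (a b c d : ℂ) : (qmk a b c d).imK = d := rfl
lemma qi0 : qi 0 = qmk 0 1 0 0 := rfl
lemma qi1 : qi 1 = qmk 0 0 1 0 := rfl
lemma qi2 : qi 2 = qmk 0 0 0 1 := rfl
lemma vecR_re (v : V3) : (vecR v).re = 0 := rfl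
lemma vecR_imI (v : V3) : (vecR v).imI = (v 0 : ℂ) := rfl
lemma vecR_imJ (v : V3) : (vecR v).imJ = (v 1 : ℂ) := rfl
lemma vecR_imK (v : V3) : (vecR v).imK = (v 2 : ℂ) := rfl

lemma cq_imI (A B : ℝ × V3 → V3) (q : ℝ × V3) :
    (cq A B q).imI = (A q 0 : ℂ) + Complex.I * (B q 0 : ℂ) := by
  simp [cq, vecR_re, vecR_imI, vecR_imJ, vecR_imK]
lemma cq_imJ (A B : ℝ × V3 → V3) (q : ℝ × V3) :
    (cq A B q).imJ = (A q 1 : ℂ) + Complex.I * (B q 1 : ℂ) := by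
  simp [cq, vecR_re, vecR_imI, vecR_imJ, vecR_imK]
lemma cq_imK (A B : ℝ × V3 → V3) (q : ℝ × V3) :
    (cq A B q).imK = (A q 2 : ℂ) + Complex.I * (B q 2 : ℂ) := by
  simp [cq, vecR_re, vecR_imI, vecR_imJ, vecR_imK]
lemma cq_re (A B : ℝ × V3 → V3) (q : ℝ × V3) : (cq A B q).re = 0 := by
  simp [cq, vecR_re, vecR_imI, vecR_imJ, vecR_imK]

lemma ptQ_cq {A B : ℝ × V3 → V3} (hA : ContDiff ℝ 1 A) (hB : ContDiff ℝ 1 B) :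
    ptQ (cq A B) = cq (ptV A) (ptV B) := by
  funext p
  have hA' := fun k => aux_slt (contDiff_pi.1 hA k) p
  have hB' := fun k => aux_slt (contDiff_pi.1 hB k) p
  have key : ∀ k, deriv (fun s => (A (s, p.2) k : ℂ) + Complex.I * (B (s, p.2) k : ℂ)) p.1
      = (ptV A p k : ℂ) + Complex.I * (ptV B p k : ℂ) := by
    intro k
    rw [aux_dt _ _ _ (hA' k).differentiableAt (hB' k).differentiableAt,
      (hA' k).deriv, (hB' k).deriv, pt_eq (n := 1) (by exact_mod_cast hA) le_rfl,
      pt_eq (n := 1) (by exact_mod_cast hB) le_rfl]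
  apply Quaternion.ext
  · simp [ptQ, cq_re]
  · simp only [ptQ, cq_imI, key]
  · simp only [ptQ, cq_imJ, key]
  · simp only [ptQ, cq_imK, key]

lemma DQ_cq {A B : ℝ × V3 → V3} (hA : ContDiff ℝ 1 A) (hB : ContDiff ℝ 1 B)
    (dA : ∀ p, div3 A p = 0) (dB : ∀ p, div3 B p = 0) :
    DQ (cq A B) = cq (rot3 A) (rot3 B) := by
  funext p
  have hA' := fun k => aux_slx (contDiff_pi.1 hA k) p
  have hB' := fun k => aux_slx (contDiff_pi.1 hB k) p
  have key : ∀ j k, pdC j (fun y => (A (p.1, y) k : ℂ) + Complex.I * (B (p.1, y) k : ℂ)) p.2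
      = (pdR j (fun y => A (p.1, y) k) p.2 : ℂ)
        + Complex.I * (pdR j (fun y => B (p.1, y) k) p.2 : ℂ) := fun j k =>
    aux_pdC _ _ _ _ (hA' k).differentiableAt (hB' k).differentiableAt
  have key0 : ∀ j, pdC j (fun _ => (0 : ℂ)) p.2 = 0 := by intro j; simp [pdC]
  have a0 := congrArg (fun x : ℝ => (x : ℂ)) (dA p)
  have b0 := congrArg (fun x : ℝ => (x : ℂ)) (dB p)
  simp only [div3, Fin.sum_univ_three, Complex.ofReal_add, Complex.ofReal_zero] at a0 b0
  have hq : ∀ j, pdQ j (fun y => cq A B (p.1, y)) p.2 = qmk 0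
      ((pdR j (fun y => A (p.1, y) 0) p.2 : ℂ) + Complex.I * (pdR j (fun y => B (p.1, y) 0) p.2 : ℂ))
      ((pdR j (fun y => A (p.1, y) 1) p.2 : ℂ) + Complex.I * (pdR j (fun y => B (p.1, y) 1) p.2 : ℂ))
      ((pdR j (fun y => A (p.1, y) 2) p.2 : ℂ) + Complex.I * (pdR j (fun y => B (p.1, y) 2) p.2 : ℂ)) := by
    intro j
    simp only [pdQ, cq_re, cq_imI, cq_imJ, cq_imK, key, key0]
    rfl
  simp only [DQ, Dop, hq]
  apply Quaternion.ext
  · simp [cq_re, qi0, qi1, qi2, qmk_re, qmk_imI, qmk_imJ, qmk_imK]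
    linear_combination -a0 - Complex.I * b0
  · simp [cq_imI, qi0, qi1, qi2, qmk_re, qmk_imI, qmk_imJ, qmk_imK, rot3]
    ring
  · simp [cq_imJ, qi0, qi1, qi2, qmk_re, qmk_imI, qmk_imJ, qmk_imK, rot3]
    ring
  · simp [cq_imK, qi0, qi1, qi2, qmk_re, qmk_imI, qmk_imJ, qmk_imK, rot3]
    ring

theorem aux_main (ε μ β : ℝ) (hε : 0 < ε) (hμ : 0 < μ)
    (U : ℝ × V3 → V3) (hU : ContDiff ℝ ((4 : ℕ) : WithTop ℕ∞) U)
    (hdiv : ∀ p : ℝ × V3, div3 U p = 0) (p : ℝ × V3) :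
      Mop ε μ β (MstarOp ε μ β (fun q => vecR (U q))) p =
        vecR (rot3 (rot3 U) p + (ε * μ) • ptV (ptV U) p
          + (2 * β * ε * μ) • ptV (ptV (rot3 U)) p
          + (β ^ 2 * ε * μ) • ptV (ptV (rot3 (rot3 U))) p) := by
  obtain ⟨s, hs⟩ : ∃ s, s = Real.sqrt (ε * μ) := ⟨_, rfl⟩
  have hss : ε * μ = s * s := by rw [hs, Real.mul_self_sqrt (by positivity)]
  have one : ∀ {E : ℝ × V3 → V3} {n : ℕ}, ContDiff ℝ n E → 1 ≤ n → ContDiff ℝ 1 E :=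
    fun h h' => h.of_le (by exact_mod_cast h')
  have hR := rot_smooth (m := 3) hU le_rfl
  have hP := pt_smooth (m := 3) hU le_rfl
  have hPR := pt_smooth (m := 2) hR le_rfl
  have hRR := rot_smooth (m := 2) hR le_rfl
  have hPRR := pt_smooth (m := 1) hRR le_rfl
  have hZ : ContDiff ℝ 1 (fun _ : ℝ × V3 => (0 : V3)) := contDiff_const
  have dZ : ∀ p, div3 (fun _ : ℝ × V3 => (0 : V3)) p = 0 := by intro p; simp [div3, pdR]
  have rZ : rot3 (fun _ : ℝ × V3 => (0 : V3)) = fun _ => 0 := by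
    funext p k; fin_cases k <;> simp [rot3, pdR]
  have pZ : ptV (fun _ : ℝ × V3 => (0 : V3)) = fun _ => 0 := by
    funext p; simp [ptV]
  have hU0 : (fun q => vecR (U q)) = cq U (fun _ => 0) := by
    funext q; apply Quaternion.ext <;> simp [cq, vecR_re, vecR_imI, vecR_imJ, vecR_imK]
  have hM : MstarOp ε μ β (fun q => vecR (U q))
      = cq (fun q => (β * s) • ptV (rot3 U) q + s • ptV U q) (rot3 U) := by
    funext q
    unfold MstarOp
    rw [hU0, DQ_cq (one hU (by norm_num)) hZ hdiv dZ, rZ, ptQ_cq (one hR (by norm_num)) hZ,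
      ptQ_cq (one hU (by norm_num)) hZ, pZ, ← hs]
    apply Quaternion.ext <;> simp [-Complex.coe_smul, cq, vecR_re, vecR_imI, vecR_imJ, vecR_imK]
  have hPR1 := one hPR (by norm_num)
  have hP1 := one hP (by norm_num)
  have hA := one (lin_smooth hPR1 hP1 (β * s) s) le_rfl
  have dR : ∀ p, div3 (rot3 U) p = 0 := div_rot hU (by norm_num)
  have dA : ∀ p, div3 (fun q => (β * s) • ptV (rot3 U) q + s • ptV U q) p = 0 := by
    intro p
    rw [div_lin hPR1 hP1, div_pt hR (by norm_num) dR, div_pt hU (by norm_num) hdiv]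
    simp
  have rA : rot3 (fun q => (β * s) • ptV (rot3 U) q + s • ptV U q)
     = fun q => (β * s) • ptV (rot3 (rot3 U)) q + s • ptV (rot3 U) q := by
    rw [rot_lin hPR1 hP1, rot_pt hR (by norm_num), rot_pt hU (by norm_num)]
  unfold Mop
  rw [hM, DQ_cq hA (one hR (by norm_num)) dA dR, ptQ_cq hA (one hR (by norm_num)), rA,
    ptQ_cq (one (lin_smooth (one hPRR le_rfl) hPR1 (β * s) s) le_rfl) (one hRR (by norm_num)),
    pt_lin (one hPRR le_rfl) hPR1, pt_lin hPR1 hP1, ← hs]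
  have e1 : 2 * β * ε * μ = 2 * β * (s * s) := by rw [← hss]; ring
  have e2 : β ^ 2 * ε * μ = β ^ 2 * (s * s) := by rw [← hss]; ring
  rw [e1, e2, hss]
  apply Quaternion.ext
  · simp [-Complex.coe_smul, cq_re, vecR_re, vecR_imI, vecR_imJ, vecR_imK]
  · simp [-Complex.coe_smul, cq_imI, vecR_re, vecR_imI, vecR_imJ, vecR_imK]
    linear_combination - (rot3 (rot3 U) p 0 : ℂ) * Complex.I_mul_I
  · simp [-Complex.coe_smul, cq_imJ, vecR_re, vecR_imI, vecR_imJ, vecR_imK]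
    linear_combination - (rot3 (rot3 U) p 1 : ℂ) * Complex.I_mul_I
  · simp [-Complex.coe_smul, cq_imK, vecR_re, vecR_imI, vecR_imJ, vecR_imK]
    linear_combination - (rot3 (rot3 U) p 2 : ℂ) * Complex.I_mul_I

/-- For a divergence-free vector field `U`, viewed as a purely
vectorial biquaternion-valued function,
`M M* U = rot rot U + εμ ∂ₜ²U + 2βεμ ∂ₜ² rot U + β²εμ ∂ₜ² rot rot U`. -/
theorem MMstar_on_divergence_free
    (ε μ β : ℝ) (hε : 0 < ε) (hμ : 0 < μ)
    (U : ℝ × V3 → V3) (hU : ContDiff ℝ 4 U)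
    (hdiv : ∀ p : ℝ × V3, div3 U p = 0) :
    ∀ p : ℝ × V3,
      Mop ε μ β (MstarOp ε μ β (fun q => vecR (U q))) p =
        vecR (rot3 (rot3 U) p + (ε * μ) • ptV (ptV U) p
          + (2 * β * ε * μ) • ptV (ptV (rot3 U)) p
          + (β ^ 2 * ε * μ) • ptV (ptV (rot3 (rot3 U))) p) := by
  exact fun p => aux_main ε μ β hε hμ U (by exact_mod_cast hU) hdiv p
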